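/- Let m ≥ 2 and define E₀(φ₁,…,φ_m) = Σ_{1 ≤ j < k ≤ m} 1/sin²((φ_j − φ_k)/2) on the set X = { (φ₁,…,φ_m) ∈ ℝ^m : φ₁ < φ₂ < … < φ_m < φ₁ + 2π and Σ_{j=1}^m φ_j = 0 }. Then the point given by φ_j = (2π/m)·(j − (m+1)/2), j = 1,…,m, lies in X, all partial derivatives of E₀ vanish at this point, and it is the unique point of X with this property. -/

import Mathlib

open Finset

/-- `E₀(φ) = Σ_{j<k} 1/sin²((φ_j - φ_k)/2)`. -/
noncomputable def E0 (m : ℕ) (φ : Fin m → ℝ) : ℝ :=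
  ∑ j, ∑ k, (if j < k then 1 / Real.sin ((φ j - φ k) / 2) ^ 2 else 0)

/-- The equidistributed angles `φ_j = (2π/m)(j - (m+1)/2)`, `j = 1, …, m`
(indexed here by `j = 0, …, m-1`). -/
noncomputable def phiStar (m : ℕ) : Fin m → ℝ :=
  fun j => (2 * Real.pi / (m : ℝ)) * (((j : ℕ) : ℝ) + 1 - ((m : ℝ) + 1) / 2)

/-- The derivative of `x ↦ 1 / sin² (x / 2)`. -/
noncomputable def pairForce (x : ℝ) : ℝ := -Real.cos (x / 2) / Real.sin (x / 2) ^ 3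

lemma hasDerivAt_one_div_sin_half_sq {x : ℝ} (hx : Real.sin (x / 2) ≠ 0) :
    HasDerivAt (fun y => 1 / Real.sin (y / 2) ^ 2) (pairForce x) x := by
  have h1 : HasDerivAt (fun y => Real.sin (y / 2)) (Real.cos (x / 2) * (1 / 2)) x :=
    ((hasDerivAt_id' x).div_const 2).sin
  have h2 := (hasDerivAt_const x (1 : ℝ)).fun_div (h1.fun_pow 2) (pow_ne_zero 2 hx)
  refine h2.congr_deriv ?_
  unfold pairForce
  field_simp
  ring

lemma sin_half_neg {x : ℝ} (hx : x ∈ Set.Ioo (-(2 * Real.pi)) 0) : Real.sin (x / 2) < 0 :=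
  Real.sin_neg_of_neg_of_neg_pi_lt (by linarith [hx.2]) (by linarith [hx.1])

lemma strictMonoOn_pairForce : StrictMonoOn pairForce (Set.Ioo (-(2 * Real.pi)) 0) := by
  have key : ∀ x ∈ Set.Ioo (-(2 * Real.pi)) 0, ∃ d, 0 < d ∧ HasDerivAt pairForce d x := by
    intro x hx
    have hs := sin_half_neg hx
    have h1 : HasDerivAt (fun y => Real.sin (y / 2)) (Real.cos (x / 2) * (1 / 2)) x :=
      ((hasDerivAt_id' x).div_const 2).sin
    have h2 : HasDerivAt (fun y => Real.cos (y / 2)) (-Real.sin (x / 2) * (1 / 2)) x :=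
      ((hasDerivAt_id' x).div_const 2).cos
    have h3 := h2.fun_neg.fun_div (h1.fun_pow 3) (pow_ne_zero 3 hs.ne)
    refine ⟨(Real.sin (x / 2) ^ 4 + 3 * (Real.sin (x / 2) * Real.cos (x / 2)) ^ 2) / 2 /
      (Real.sin (x / 2) ^ 3) ^ 2, ?_, h3.congr_deriv ?_⟩
    · have : 0 < Real.sin (x / 2) ^ 4 :=
        Even.pow_pos (by decide) hs.ne
      have := pow_ne_zero 3 hs.ne
      positivity
    · congr 1
      push_cast
      ring
  refine strictMonoOn_of_deriv_pos (convex_Ioo _ _) (fun x hx => ?_) (fun x hx => ?_)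
  · obtain ⟨d, -, hd⟩ := key x hx
    exact hd.continuousAt.continuousWithinAt
  · rw [interior_Ioo] at hx
    obtain ⟨d, hd0, hd⟩ := key x hx
    rwa [hd.deriv]

lemma pairForce_neg (x : ℝ) : pairForce (-x) = -pairForce x := by
  unfold pairForce
  rw [neg_div 2 x, Real.cos_neg, Real.sin_neg, Odd.neg_pow (by decide), div_neg]

lemma pairForce_periodic : Function.Periodic pairForce (2 * Real.pi) := by
  intro x
  unfold pairForce
  rw [show (x + 2 * Real.pi) / 2 = x / 2 + Real.pi by ring, Real.cos_add_pi, Real.sin_add_pi,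
    Odd.neg_pow (by decide), neg_div_neg_eq, neg_div]

lemma fderiv_E0_apply {m : ℕ} {φ : Fin m → ℝ}
    (hφ : ∀ j k, j < k → φ j - φ k ∈ Set.Ioo (-(2 * Real.pi)) 0) (v : Fin m → ℝ) :
    fderiv ℝ (E0 m) φ v =
      ∑ j, ∑ k, (if j < k then pairForce (φ j - φ k) * (v j - v k) else 0) := by
  have hterm : ∀ j k : Fin m, HasFDerivAt
      (fun φ : Fin m → ℝ => if j < k then 1 / Real.sin ((φ j - φ k) / 2) ^ 2 else 0)
      (if j < k then pairForce (φ j - φ k) •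
        (ContinuousLinearMap.proj (R := ℝ) (φ := fun _ : Fin m => ℝ) j -
          ContinuousLinearMap.proj (R := ℝ) (φ := fun _ : Fin m => ℝ) k) else 0) φ := by
    intro j k
    split_ifs with hjk
    · exact (hasDerivAt_one_div_sin_half_sq (sin_half_neg (hφ j k hjk)).ne).comp_hasFDerivAt
        (f := fun φ : Fin m → ℝ => φ j - φ k) φ
        ((hasFDerivAt_apply j φ).fun_sub (hasFDerivAt_apply k φ))
    · exact hasFDerivAt_const _ _
  have hsum : HasFDerivAt (E0 m) _ φ :=
    HasFDerivAt.fun_sum fun j _ => HasFDerivAt.fun_sum fun k _ => hterm j k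
  rw [hsum.fderiv]
  simp only [_root_.sum_apply]
  refine Finset.sum_congr rfl fun j _ => Finset.sum_congr rfl fun k _ => ?_
  split_ifs <;> simp

lemma sub_mem_Ioo_of_strictMono {m : ℕ} {φ : Fin m → ℝ} (hmono : StrictMono φ) {a b : Fin m}
    (ha : ∀ j, a ≤ j) (hb : ∀ j, j ≤ b) (hlt : φ b < φ a + 2 * Real.pi) (j k : Fin m)
    (hjk : j < k) : φ j - φ k ∈ Set.Ioo (-(2 * Real.pi)) 0 := by
  have h1 := hmono.monotone (ha j)
  have h2 := hmono.monotone (hb k)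
  have h3 := hmono hjk
  constructor <;> linarith

lemma phiStar_sub {m : ℕ} (j k : Fin m) :
    phiStar m j - phiStar m k = (((j : ℕ) : ℝ) - ((k : ℕ) : ℝ)) * (2 * Real.pi / m) := by
  unfold phiStar
  ring

lemma sum_pairForce_phiStar {m : ℕ} (j : Fin m) :
    ∑ k, pairForce (phiStar m j - phiStar m k) = 0 := by
  have hpos : 0 < m := j.pos
  have : NeZero m := ⟨hpos.ne'⟩
  have hm0 : (m : ℝ) ≠ 0 := by exact_mod_cast hpos.ne'
  have hrefl : ∀ k : Fin m, pairForce (phiStar m j - phiStar m (j + j - k)) =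
      -pairForce (phiStar m j - phiStar m k) := by
    intro k
    have hz : ∃ z : ℤ, (((j + j - k : Fin m) : ℕ) : ℤ) = j + j - k + z * m := by
      have h1 := Nat.mod_add_div (m - k + (j + j : Fin m)) m
      have h2 := Nat.mod_add_div ((j : ℕ) + j) m
      rw [← Fin.val_sub] at h1
      rw [← Fin.val_add] at h2
      have hk := k.isLt.le
      zify [hk] at h1 h2
      refine ⟨1 - ((m - k + (j + j : Fin m)) / m : ℤ) - ((j + j : ℤ) / m), ?_⟩
      linear_combination h1 + h2
    obtain ⟨z, hz⟩ := hz
    have hzr : (((j + j - k : Fin m) : ℕ) : ℝ) = (j : ℕ) + (j : ℕ) - (k : ℕ) + z * m := by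
      exact_mod_cast hz
    rw [← pairForce_neg, ← pairForce_periodic.sub_int_mul_eq (x := -(phiStar m j - phiStar m k)) z, phiStar_sub, phiStar_sub, hzr]
    congr 1
    field_simp
    ring
  have h := (Equiv.subLeft (j + j)).sum_comp fun k => pairForce (phiStar m j - phiStar m k)
  simp only [Equiv.subLeft_apply, hrefl, Finset.sum_neg_distrib] at h
  linarith

lemma sum_lt_mul_sub_eq {m : ℕ} (F : Fin m → Fin m → ℝ) (hF : ∀ j k, F k j = -F j k)
    (v : Fin m → ℝ) :
    ∑ j, ∑ k, (if j < k then F j k * (v j - v k) else 0) = ∑ j, v j * ∑ k, F j k := by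
  have hdiag : ∀ j, F j j = 0 := fun j => by linarith [hF j j]
  have hsplit : ∀ j k, v j * F j k =
      (if j < k then v j * F j k else 0) + (if k < j then v j * F j k else 0) := by
    intro j k
    rcases lt_trichotomy j k with h | rfl | h
    · simp [h, h.asymm]
    · simp [hdiag]
    · simp [h, h.asymm]
  have hsum : ∑ j, v j * ∑ k, F j k = ∑ j, ∑ k,
      ((if j < k then v j * F j k else 0) + (if k < j then v j * F j k else 0)) := by
    simp only [Finset.mul_sum, ← hsplit]
  rw [hsum]
  simp only [Finset.sum_add_distrib]
  rw [Finset.sum_comm (f := fun j k => if k < j then v j * F j k else 0)]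
  simp only [← Finset.sum_add_distrib]
  refine Finset.sum_congr rfl fun j _ => Finset.sum_congr rfl fun k _ => ?_
  split_ifs
  · rw [hF j k]
    ring
  · simp

lemma phiStar_strictMono (m : ℕ) : StrictMono (phiStar m) := by
  intro j k hjk
  have hm : (0 : ℝ) < m := by exact_mod_cast j.pos
  have hjk' : ((j : ℕ) : ℝ) < (k : ℕ) := by exact_mod_cast hjk
  rw [← sub_neg, phiStar_sub]
  exact mul_neg_of_neg_of_pos (by linarith) (by positivity)

lemma sum_phiStar {m : ℕ} : ∑ j, phiStar m j = 0 := by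
  have h := Equiv.sum_comp Fin.revPerm (phiStar m)
  have hrev : ∀ j, phiStar m (Fin.revPerm j) = -phiStar m j := by
    intro j
    have : (((Fin.rev j : Fin m) : ℕ) : ℝ) = m - ((j : ℕ) + 1) := by
      rw [Fin.val_rev, Nat.cast_sub j.isLt]
      push_cast
      ring
    rw [Fin.revPerm_apply]
    unfold phiStar
    rw [this]
    ring
  simp only [hrev, Finset.sum_neg_distrib] at h
  linarith

/-- Two points with the same differences and vanishing coordinate sums are equal. -/
lemma eq_of_sub_eq_of_sum_eq_zero {m : ℕ} {φ ψ : Fin m → ℝ}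
    (h : ∀ j k, j < k → ψ j - ψ k = φ j - φ k) (hφ : ∑ j, φ j = 0) (hψ : ∑ j, ψ j = 0) :
    ψ = φ := by
  funext j
  have hall : ∀ k, ψ k - φ k = ψ j - φ j := by
    intro k
    rcases lt_trichotomy j k with hjk | rfl | hjk
    · linarith [h j k hjk]
    · rfl
    · linarith [h k j hjk]
  have hsum : ∑ k, (ψ k - φ k) = 0 := by rw [Finset.sum_sub_distrib, hφ, hψ, sub_zero]
  simp only [hall, Finset.sum_const, Finset.card_univ, Fintype.card_fin, nsmul_eq_mul] at hsum
  have hm : (m : ℝ) ≠ 0 := by exact_mod_cast j.pos.ne'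
  linarith [(mul_eq_zero.1 hsum).resolve_left hm]

theorem stmt11 (m : ℕ) (hm : 2 ≤ m) :
    StrictMono (phiStar m) ∧
    phiStar m ⟨m - 1, by omega⟩ < phiStar m ⟨0, by omega⟩ + 2 * Real.pi ∧
    (∑ j, phiStar m j = 0) ∧
    fderiv ℝ (E0 m) (phiStar m) = 0 ∧
    (∀ ψ : Fin m → ℝ, StrictMono ψ →
      ψ ⟨m - 1, by omega⟩ < ψ ⟨0, by omega⟩ + 2 * Real.pi →
      (∑ j, ψ j = 0) → fderiv ℝ (E0 m) ψ = 0 → ψ = phiStar m) := by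
  have hm0 : (0 : ℝ) < m := by exact_mod_cast (by omega : 0 < m)
  have hlt : phiStar m ⟨m - 1, by omega⟩ < phiStar m ⟨0, by omega⟩ + 2 * Real.pi := by
    rw [← sub_lt_iff_lt_add', phiStar_sub, Nat.cast_sub (by omega), Nat.cast_one, Nat.cast_zero,
      sub_zero, mul_div_assoc', div_lt_iff₀ hm0]
    nlinarith [Real.pi_pos]
  have hfirst : ∀ j : Fin m, ⟨0, by omega⟩ ≤ j := fun j => Fin.mk_le_of_le_val (Nat.zero_le _)
  have hlast : ∀ j : Fin m, j ≤ ⟨m - 1, by omega⟩ := fun j => Fin.le_def.2 (by simp; omega)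
  have hmem := sub_mem_Ioo_of_strictMono (phiStar_strictMono m) hfirst hlast hlt
  have hcrit : fderiv ℝ (E0 m) (phiStar m) = 0 := by
    ext1 v
    rw [fderiv_E0_apply hmem,
      sum_lt_mul_sub_eq (fun j k => pairForce (phiStar m j - phiStar m k))
        (fun j k => by rw [← pairForce_neg, neg_sub])]
    simp [sum_pairForce_phiStar]
  refine ⟨phiStar_strictMono m, hlt, sum_phiStar, hcrit, fun ψ hψ hψlt hψsum hψcrit => ?_⟩
  have hψmem := sub_mem_Ioo_of_strictMono hψ hfirst hlast hψlt
  refine eq_of_sub_eq_of_sum_eq_zero ?_ sum_phiStar hψsum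
  have h1 := fderiv_E0_apply hψmem (ψ - phiStar m)
  have h2 := fderiv_E0_apply hmem (ψ - phiStar m)
  rw [hψcrit] at h1
  rw [hcrit] at h2
  have hterm : ∀ j k, j < k → ψ j - ψ k ≠ phiStar m j - phiStar m k →
      0 < pairForce (ψ j - ψ k) * ((ψ - phiStar m) j - (ψ - phiStar m) k) -
        pairForce (phiStar m j - phiStar m k) * ((ψ - phiStar m) j - (ψ - phiStar m) k) := by
    intro j k hjk hne
    simp only [Pi.sub_apply]
    rcases hne.lt_or_gt with h | h
    · have := strictMonoOn_pairForce (hψmem j k hjk) (hmem j k hjk) h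
      nlinarith
    · have := strictMonoOn_pairForce (hmem j k hjk) (hψmem j k hjk) h
      nlinarith
  have hnonneg : ∀ j k, 0 ≤
      (if j < k then pairForce (ψ j - ψ k) * ((ψ - phiStar m) j - (ψ - phiStar m) k) else 0) -
      (if j < k then pairForce (phiStar m j - phiStar m k) *
        ((ψ - phiStar m) j - (ψ - phiStar m) k) else 0) := by
    intro j k
    split_ifs with hjk
    · by_cases hne : ψ j - ψ k = phiStar m j - phiStar m k
      · rw [hne, sub_self]
      · exact (hterm j k hjk hne).le
    · simp
  have hzero := h1.symm.trans h2
  rw [← sub_eq_zero] at hzero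
  simp only [← Finset.sum_sub_distrib] at hzero
  rw [Finset.sum_eq_zero_iff_of_nonneg
    (fun j _ => Finset.sum_nonneg fun k _ => hnonneg j k)] at hzero
  intro j k hjk
  by_contra hne
  have hj := hzero j (Finset.mem_univ j)
  rw [Finset.sum_eq_zero_iff_of_nonneg (fun k _ => hnonneg j k)] at hj
  have hk := hj k (Finset.mem_univ k)
  rw [if_pos hjk, if_pos hjk] at hk
  exact (hterm j k hjk hne).ne' hk
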